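/- Let d ≥ 1 and let K ⊂ ℝ^d be a convex body whose centre of mass is the origin and such that K ∩ ℤ^d = {0}. Then vol(K) ≤ exp(−d/(2^16 · L_K²)) · 4^d, where L_K is the isotropic constant of K. -/

import Mathlib

open MeasureTheory Pointwise

/-- The centre of mass of `K`. -/
noncomputable def centroid {d : ℕ} (K : Set (EuclideanSpace ℝ (Fin d))) :
    EuclideanSpace ℝ (Fin d) :=
  (volume K).toReal⁻¹ • ∫ x in K, x

/-- The covariance matrix `Σ_K = E[(X - E X) ⊗ (X - E X)]` of a uniformly random point
`X` of `K`. -/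
noncomputable def covMatrix {d : ℕ} (K : Set (EuclideanSpace ℝ (Fin d))) :
    Matrix (Fin d) (Fin d) ℝ :=
  fun i j => (volume K).toReal⁻¹ * ∫ x in K, (x i - centroid K i) * (x j - centroid K j)

/-- The isotropic constant `L_K = (√(det Σ_K) / vol(K))^(1/d)`. -/
noncomputable def isotropicConstant {d : ℕ} (K : Set (EuclideanSpace ℝ (Fin d))) : ℝ :=
  (Real.sqrt (covMatrix K).det / (volume K).toReal) ^ ((d : ℝ)⁻¹)

/-- The integer lattice `ℤ^d` inside `ℝ^d`. -/
def intLattice (d : ℕ) : Set (EuclideanSpace ℝ (Fin d)) :=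
  {x | ∀ i, ∃ n : ℤ, x i = (n : ℝ)}

section PrekopaLeindler

open scoped ENNReal

/-- One-dimensional Brunn–Minkowski inequality for compact sets. -/
theorem volume_compact_weighted_add_le {A B C : Set ℝ} (hA : IsCompact A) (hB : IsCompact B)
    (hA' : A.Nonempty) (hB' : B.Nonempty) {a b : ℝ} (ha : 0 < a) (hb : 0 < b)
    (h : ∀ x ∈ A, ∀ y ∈ B, a * x + b * y ∈ C) :
    ENNReal.ofReal a * volume A + ENNReal.ofReal b * volume B ≤ volume C := by
  obtain ⟨M, hMA, hM⟩ := hA.exists_isGreatest hA'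
  obtain ⟨m, hmB, hm⟩ := hB.exists_isLeast hB'
  set p := a * M + b * m with hp
  have scale : ∀ (c t : ℝ) (S : Set ℝ), 0 < c →
      volume ((fun x => c * x + t) '' S) = ENNReal.ofReal c * volume S := by
    intro c t S hc
    have : (fun x => c * x + t) '' S = (fun x => x + t) '' (c • S) := by
      rw [← Set.image_smul, Set.image_image]
      rfl
    rw [this, Set.image_add_right, measure_preimage_add_right, Measure.addHaar_smul]
    simp [abs_of_pos hc]
  have h1 : ENNReal.ofReal a * volume A ≤ volume (C ∩ Set.Iic p) := by
    rw [← scale a (b * m) A ha]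
    apply measure_mono
    rintro _ ⟨x, hx, rfl⟩
    refine ⟨h x hx m hmB, ?_⟩
    have := hM hx
    simp only [Set.mem_Iic, hp]
    gcongr
  have h2 : ENNReal.ofReal b * volume B ≤ volume (C \ Set.Iic p) := by
    rw [← scale b (a * M) B hb, ← measure_sdiff_null (s := _ '' B) (measure_singleton (μ := volume) p)]
    apply measure_mono
    rintro _ ⟨⟨y, hy, rfl⟩, hne⟩
    refine ⟨by simpa [add_comm] using h M hMA y hy, ?_⟩
    have h3 : b * m ≤ b * y := mul_le_mul_of_nonneg_left (hm hy) hb.le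
    simp only [Set.mem_Iic, not_le]
    refine lt_of_le_of_ne (by simp only [hp]; linarith) (fun h => hne h.symm)
  calc _ ≤ volume (C ∩ Set.Iic p) + volume (C \ Set.Iic p) := add_le_add h1 h2
    _ = volume C := measure_inter_add_sdiff _ measurableSet_Iic

/-- One-dimensional Brunn–Minkowski inequality for measurable sets. -/
theorem volume_weighted_add_le {A B C : Set ℝ} (hA : MeasurableSet A) (hB : MeasurableSet B)
    (hA' : A.Nonempty) (hB' : B.Nonempty) {a b : ℝ} (ha : 0 < a) (hb : 0 < b)
    (h : ∀ x ∈ A, ∀ y ∈ B, a * x + b * y ∈ C) :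
    ENNReal.ofReal a * volume A + ENNReal.ofReal b * volume B ≤ volume C := by
  obtain ⟨x₀, hx₀⟩ := hA'
  obtain ⟨y₀, hy₀⟩ := hB'
  simp only [hA.measure_eq_iSup_isCompact, hB.measure_eq_iSup_isCompact, ENNReal.mul_iSup,
    iSup_and']
  refine ENNReal.biSup_add_biSup_le' ⟨∅, by simp⟩ ⟨∅, by simp⟩ ?_
  rintro S ⟨hSA, hS⟩ T ⟨hTB, hT⟩
  calc _ ≤ ENNReal.ofReal a * volume (insert x₀ S) + ENNReal.ofReal b * volume (insert y₀ T) := by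
        gcongr <;> exact Set.subset_insert _ _
    _ ≤ _ := volume_compact_weighted_add_le (hS.insert _) (hT.insert _)
        (Set.insert_nonempty _ _) (Set.insert_nonempty _ _) ha hb fun x hx y hy =>
          h x (Set.insert_subset hx₀ hSA hx) y (Set.insert_subset hy₀ hTB hy)

theorem lintegral_eq_lintegral_meas_ofReal_lt {α : Type*} [MeasurableSpace α] {μ : Measure α}
    {f : α → ℝ≥0∞} (hf : Measurable f) (hfin : ∀ x, f x ≠ ∞) :
    ∫⁻ x, f x ∂μ = ∫⁻ t in Set.Ioi (0 : ℝ), μ {x | ENNReal.ofReal t < f x} := by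
  have h := lintegral_eq_lintegral_meas_lt (f := fun x => (f x).toReal) μ
    (Filter.Eventually.of_forall fun _ => ENNReal.toReal_nonneg) hf.ennreal_toReal.aemeasurable
  simp only [ENNReal.ofReal_toReal (hfin _)] at h
  rw [h]
  refine setLIntegral_congr_fun measurableSet_Ioi fun t ht => ?_
  simp only [ENNReal.ofReal_lt_iff_lt_toReal (le_of_lt ht) (hfin _)]

theorem ENNReal.geom_mean_le_arith_mean2_weighted (x y : ℝ≥0∞) {a b : ℝ} (ha : 0 < a)
    (hb : 0 < b) (hab : a + b = 1) :
    x ^ a * y ^ b ≤ ENNReal.ofReal a * x + ENNReal.ofReal b * y := by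
  have hc : (a⁻¹).HolderConjugate b⁻¹ := by
    rw [Real.holderConjugate_iff]
    refine ⟨(one_lt_inv₀ ha).2 (by linarith), by simpa using hab⟩
  have h := ENNReal.young_inequality (x ^ a) (y ^ b) hc
  rw [← ENNReal.rpow_mul, ← ENNReal.rpow_mul, mul_inv_cancel₀ ha.ne', mul_inv_cancel₀ hb.ne',
    ENNReal.ofReal_inv_of_pos ha, ENNReal.ofReal_inv_of_pos hb, ENNReal.rpow_one,
    ENNReal.rpow_one] at h
  simpa [div_eq_mul_inv, mul_comm] using h

/-- The one-dimensional Prékopa–Leindler inequality in arithmetic form for functions with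
supremum one. -/
theorem lintegral_weighted_add_le_of_iSup_eq_one {f g h : ℝ → ℝ≥0∞} (hf : Measurable f)
    (hg : Measurable g) (hh : Measurable h) (hf1 : ⨆ x, f x = 1) (hg1 : ⨆ x, g x = 1)
    {a b : ℝ} (ha : 0 < a) (hb : 0 < b) (hab : a + b = 1)
    (hfgh : ∀ x y, f x ^ a * g y ^ b ≤ h (a * x + b * y)) :
    ENNReal.ofReal a * (∫⁻ x, f x) + ENNReal.ofReal b * (∫⁻ x, g x) ≤ ∫⁻ x, h x := by
  have hfle : ∀ x, f x ≤ 1 := fun x => hf1 ▸ le_iSup f x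
  have hgle : ∀ x, g x ≤ 1 := fun x => hg1 ▸ le_iSup g x
  have key : ENNReal.ofReal a * (∫⁻ x, f x) + ENNReal.ofReal b * (∫⁻ x, g x)
      ≤ ∫⁻ x, min (h x) 1 := by
    rw [lintegral_eq_lintegral_meas_ofReal_lt hf fun x => ((hfle x).trans_lt ENNReal.one_lt_top).ne,
      lintegral_eq_lintegral_meas_ofReal_lt hg fun x => ((hgle x).trans_lt ENNReal.one_lt_top).ne,
      lintegral_eq_lintegral_meas_ofReal_lt (hh.min measurable_const)
        fun x => ((min_le_right _ _).trans_lt ENNReal.one_lt_top).ne]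
    have meas : ∀ u : ℝ → ℝ≥0∞,
        Measurable fun t : ℝ => volume {x | ENNReal.ofReal t < u x} := fun u =>
      Antitone.measurable fun s t hst => measure_mono fun x hx =>
        (ENNReal.ofReal_le_ofReal hst).trans_lt hx
    rw [← lintegral_const_mul _ (meas f), ← lintegral_const_mul _ (meas g),
      ← lintegral_add_left ((meas f).const_mul _)]
    refine lintegral_mono fun t => ?_
    rcases le_or_gt 1 (ENNReal.ofReal t) with ht | ht
    · have e1 : {x | ENNReal.ofReal t < f x} = ∅ := by
        ext x; simpa using (hfle x).trans ht
      have e2 : {x | ENNReal.ofReal t < g x} = ∅ := by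
        ext x; simpa using (hgle x).trans ht
      simp [e1, e2]
    · refine volume_weighted_add_le (measurableSet_lt measurable_const hf)
        (measurableSet_lt measurable_const hg) ?_ ?_ ha hb ?_
      · exact lt_iSup_iff.1 (hf1 ▸ ht)
      · exact lt_iSup_iff.1 (hg1 ▸ ht)
      · intro x hx y hy
        refine lt_min (lt_of_lt_of_le ?_ (hfgh x y)) ht
        calc ENNReal.ofReal t = ENNReal.ofReal t ^ a * ENNReal.ofReal t ^ b := by
              rw [← ENNReal.rpow_add_of_nonneg _ _ ha.le hb.le, hab, ENNReal.rpow_one]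
          _ < f x ^ a * g y ^ b :=
              ENNReal.mul_lt_mul (ENNReal.rpow_lt_rpow hx ha) (ENNReal.rpow_lt_rpow hy hb)
  exact key.trans (lintegral_mono fun x => min_le_left _ _)

theorem prekopaLeindler_real_of_bounded {f g h : ℝ → ℝ≥0∞} (hf : Measurable f)
    (hg : Measurable g) (hh : Measurable h) (hf1 : ⨆ x, f x ≠ ∞) (hg1 : ⨆ x, g x ≠ ∞)
    {a b : ℝ} (ha : 0 < a) (hb : 0 < b) (hab : a + b = 1)
    (hfgh : ∀ x y, f x ^ a * g y ^ b ≤ h (a * x + b * y)) :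
    (∫⁻ x, f x) ^ a * (∫⁻ x, g x) ^ b ≤ ∫⁻ x, h x := by
  set F := ⨆ x, f x with hF
  set G := ⨆ x, g x with hG
  by_cases hF0 : F = 0
  · have : ∀ x, f x = 0 := fun x => le_antisymm (hF0 ▸ le_iSup f x) bot_le
    simp [this, ha]
  by_cases hG0 : G = 0
  · have : ∀ x, g x = 0 := fun x => le_antisymm (hG0 ▸ le_iSup g x) bot_le
    simp [this, hb]
  have hFa : F ^ a ≠ 0 := by simp [hF0, hf1]
  have hFa' : F ^ a ≠ ∞ := by simp [hF0, hf1]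
  have hGb : G ^ b ≠ 0 := by simp [hG0, hg1]
  have hGb' : G ^ b ≠ ∞ := by simp [hG0, hg1]
  have key := lintegral_weighted_add_le_of_iSup_eq_one (f := fun x => F⁻¹ * f x)
    (g := fun x => G⁻¹ * g x) (h := fun x => ((F ^ a)⁻¹ * (G ^ b)⁻¹) * h x)
    (hf.const_mul _) (hg.const_mul _) (hh.const_mul _)
    (by rw [← ENNReal.mul_iSup, ← hF, ENNReal.inv_mul_cancel hF0 hf1])
    (by rw [← ENNReal.mul_iSup, ← hG, ENNReal.inv_mul_cancel hG0 hg1]) ha hb hab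
    (fun x y => by
      rw [ENNReal.mul_rpow_of_nonneg _ _ ha.le, ENNReal.mul_rpow_of_nonneg _ _ hb.le,
        ENNReal.inv_rpow, ENNReal.inv_rpow, mul_mul_mul_comm]
      gcongr
      exact hfgh x y)
  rw [lintegral_const_mul _ hf, lintegral_const_mul _ hg, lintegral_const_mul _ hh] at key
  have h2 := (ENNReal.geom_mean_le_arith_mean2_weighted (F⁻¹ * ∫⁻ x, f x) (G⁻¹ * ∫⁻ x, g x)
    ha hb hab).trans key
  rw [ENNReal.mul_rpow_of_nonneg _ _ ha.le, ENNReal.mul_rpow_of_nonneg _ _ hb.le,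
        ENNReal.inv_rpow, ENNReal.inv_rpow, mul_mul_mul_comm] at h2
  refine (ENNReal.mul_le_mul_iff_right ?_ ?_).1 h2
  · simp [hFa', hGb']
  · exact ENNReal.mul_ne_top (by simpa using hFa) (by simpa using hGb)

/-- The one-dimensional Prékopa–Leindler inequality. -/
theorem prekopaLeindler_real {f g h : ℝ → ℝ≥0∞} (hf : Measurable f)
    (hg : Measurable g) (hh : Measurable h)
    {a b : ℝ} (ha : 0 < a) (hb : 0 < b) (hab : a + b = 1)
    (hfgh : ∀ x y, f x ^ a * g y ^ b ≤ h (a * x + b * y)) :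
    (∫⁻ x, f x) ^ a * (∫⁻ x, g x) ^ b ≤ ∫⁻ x, h x := by
  have trunc : ∀ u : ℝ → ℝ≥0∞, Measurable u →
      Filter.Tendsto (fun n : ℕ => ∫⁻ x, min (u x) n) Filter.atTop (nhds (∫⁻ x, u x)) := by
    intro u hu
    refine lintegral_tendsto_of_tendsto_of_monotone (fun n => (hu.min measurable_const).aemeasurable)
      (Filter.Eventually.of_forall fun x m n hmn =>
        min_le_min_left _ (Nat.cast_le.2 hmn)) (Filter.Eventually.of_forall fun x => ?_)
    have := (tendsto_const_nhds (x := u x)).min ENNReal.tendsto_nat_nhds_top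
    simpa using this
  by_cases hf0 : ∫⁻ x, f x = 0
  · simp [hf0, ha]
  by_cases hg0 : ∫⁻ x, g x = 0
  · simp [hg0, hb]
  have lim : Filter.Tendsto (fun n : ℕ => (∫⁻ x, min (f x) n) ^ a * (∫⁻ x, min (g x) n) ^ b)
      Filter.atTop (nhds ((∫⁻ x, f x) ^ a * (∫⁻ x, g x) ^ b)) := by
    refine ENNReal.Tendsto.mul ((trunc f hf).ennrpow_const a) (Or.inl ?_)
      ((trunc g hg).ennrpow_const b) (Or.inl ?_)
    · simp [hf0, ha, ha.not_gt]
    · simp [hg0, hb, hb.not_gt]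
  refine le_of_tendsto' lim fun n => ?_
  have bdd : ∀ u : ℝ → ℝ≥0∞, ⨆ x, min (u x) n ≠ ∞ := fun u =>
    ((iSup_le fun x => min_le_right _ _).trans_lt (ENNReal.natCast_lt_top n)).ne
  refine prekopaLeindler_real_of_bounded (hf.min measurable_const) (hg.min measurable_const) hh
    (bdd f) (bdd g) ha hb hab fun x y => le_trans ?_ (hfgh x y)
  gcongr <;> exact min_le_left _ _

/-- The Prékopa–Leindler inequality. -/
theorem prekopaLeindler_pi {a b : ℝ} (ha : 0 < a) (hb : 0 < b) (hab : a + b = 1) (n : ℕ)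
    {f g h : (Fin n → ℝ) → ℝ≥0∞} (hf : Measurable f) (hg : Measurable g) (hh : Measurable h)
    (hfgh : ∀ x y, f x ^ a * g y ^ b ≤ h (a • x + b • y)) :
    (∫⁻ x, f x) ^ a * (∫⁻ x, g x) ^ b ≤ ∫⁻ x, h x := by
  induction n with
  | zero =>
    have e : ∀ u : (Fin 0 → ℝ) → ℝ≥0∞, ∫⁻ x, u x = u 0 := by
      intro u
      rw [volume_pi, Measure.pi_of_empty _ (0 : Fin 0 → ℝ), lintegral_dirac]
    simpa [e] using hfgh 0 0
  | succ n ih =>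
    have hmp := (volume_preserving_piFinSuccAbove (fun _ : Fin (n + 1) => ℝ) 0).symm
    have fub : ∀ u : (Fin (n + 1) → ℝ) → ℝ≥0∞, Measurable u →
        ∫⁻ x, u x = ∫⁻ s : ℝ, ∫⁻ z : Fin n → ℝ, u (Fin.cons s z) := by
      intro u hu
      rw [← hmp.lintegral_comp_emb (MeasurableEquiv.measurableEmbedding _), Measure.volume_eq_prod,
        lintegral_prod (fun p => u _)
          (hu.comp (MeasurableEquiv.measurable _)).aemeasurable]
      simp only [MeasurableEquiv.piFinSuccAbove, Fin.insertNthEquiv_zero]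
      rfl
    have hcons : Measurable fun p : ℝ × (Fin n → ℝ) => (Fin.cons p.1 p.2 : Fin (n + 1) → ℝ) := by
      refine measurable_pi_iff.2 fun i => Fin.cases ?_ (fun j => ?_) i
      · simpa using measurable_fst
      · simp only [Fin.cons_succ]
        fun_prop
    have slice : ∀ u : (Fin (n + 1) → ℝ) → ℝ≥0∞, Measurable u → ∀ s : ℝ,
        Measurable fun z : Fin n → ℝ => u (Fin.cons s z) := fun u hu s =>
      hu.comp (hcons.comp measurable_prodMk_left)
    have marg : ∀ u : (Fin (n + 1) → ℝ) → ℝ≥0∞, Measurable u →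
        Measurable fun s : ℝ => ∫⁻ z : Fin n → ℝ, u (Fin.cons s z) := fun u hu =>
      (hu.comp hcons).lintegral_prod_right'
    rw [fub f hf, fub g hg, fub h hh]
    refine prekopaLeindler_real (marg f hf) (marg g hg) (marg h hh) ha hb hab fun s t => ?_
    refine ih (slice f hf s) (slice g hg t) (slice h hh _) fun x y => ?_
    refine (hfgh _ _).trans_eq ?_
    congr 1
    ext i
    refine Fin.cases ?_ (fun j => ?_) i <;> simp

/-- The multiplicative Brunn–Minkowski inequality. -/
theorem volume_rpow_mul_volume_rpow_le {d : ℕ} {A B C : Set (EuclideanSpace ℝ (Fin d))}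
    (hA : MeasurableSet A) (hB : MeasurableSet B) (hC : MeasurableSet C) {a b : ℝ} (ha : 0 < a)
    (hb : 0 < b) (hab : a + b = 1) (h : ∀ x ∈ A, ∀ y ∈ B, a • x + b • y ∈ C) :
    volume A ^ a * volume B ^ b ≤ volume C := by
  have hmp := EuclideanSpace.volume_preserving_symm_measurableEquiv_toLp (Fin d)
  have hmp' := hmp.symm
  have hm : Measurable (WithLp.toLp 2 : (Fin d → ℝ) → EuclideanSpace ℝ (Fin d)) :=
    (MeasurableEquiv.toLp 2 (Fin d → ℝ)).measurable
  have vol : ∀ S : Set (EuclideanSpace ℝ (Fin d)), MeasurableSet S →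
      volume S = ∫⁻ x : Fin d → ℝ, S.indicator 1 (WithLp.toLp 2 x) := by
    intro S hS
    rw [← lintegral_indicator_one hS, ← hmp'.lintegral_comp_emb (MeasurableEquiv.measurableEmbedding _)]
    rfl
  rw [vol A hA, vol B hB, vol C hC]
  refine prekopaLeindler_pi ha hb hab d ((measurable_one.indicator hA).comp hm)
    ((measurable_one.indicator hB).comp hm) ((measurable_one.indicator hC).comp hm) fun x y => ?_
  by_cases hx : WithLp.toLp 2 x ∈ A
  · by_cases hy : WithLp.toLp 2 y ∈ B
    · have := h _ hx _ hy
      simp [hx, hy, this]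
    · simp [hy, hb]
  · simp [hx, ha]

end PrekopaLeindler

section Reflection

open scoped ENNReal

variable {d : ℕ} {K : Set (EuclideanSpace ℝ (Fin d))}

/-- The volume of the intersection of `K` with its reflection in the point `z`. -/
noncomputable def reflectionVolume (K : Set (EuclideanSpace ℝ (Fin d)))
    (z : EuclideanSpace ℝ (Fin d)) : ℝ≥0∞ :=
  volume {x | x ∈ K ∧ (2 : ℝ) • z - x ∈ K}

theorem measurableSet_reflection (hK : MeasurableSet K) (z : EuclideanSpace ℝ (Fin d)) :
    MeasurableSet {x | x ∈ K ∧ (2 : ℝ) • z - x ∈ K} :=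
  hK.inter ((measurable_const.sub measurable_id) hK)

theorem reflectionVolume_ne_top (hK : IsCompact K) (z : EuclideanSpace ℝ (Fin d)) :
    reflectionVolume K z ≠ ∞ :=
  ((measure_mono fun _ hx => hx.1).trans_lt hK.measure_lt_top).ne

theorem reflectionVolume_pos {z : EuclideanSpace ℝ (Fin d)} (hz : z ∈ interior K) :
    0 < reflectionVolume K z := by
  have hopen : IsOpen (interior K ∩ (fun x => (2 : ℝ) • z - x) ⁻¹' interior K) :=
    isOpen_interior.inter (isOpen_interior.preimage (by fun_prop))
  refine (hopen.measure_pos volume ⟨z, hz, ?_⟩).trans_le (measure_mono ?_)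
  · simpa [two_smul] using hz
  · exact fun x hx => ⟨interior_subset hx.1, interior_subset hx.2⟩

theorem reflectionVolume_eq_zero (hK : Convex ℝ K) {z : EuclideanSpace ℝ (Fin d)} (hz : z ∉ K) :
    reflectionVolume K z = 0 := by
  have : {x | x ∈ K ∧ (2 : ℝ) • z - x ∈ K} = ∅ := by
    ext x
    simp only [Set.mem_ofPred_eq, Set.mem_empty_iff_false, iff_false, not_and]
    intro hx hx'
    refine hz ?_
    have := hK hx hx' (by norm_num : (0 : ℝ) ≤ 1 / 2) (by norm_num : (0 : ℝ) ≤ 1 / 2) (by norm_num)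
    convert this using 1
    module
  rw [reflectionVolume, this, measure_empty]

/-- The volume of the intersection of a convex body with its reflections is log-concave. -/
theorem concaveOn_log_reflectionVolume (hK : IsCompact K) (hc : Convex ℝ K) :
    ConcaveOn ℝ (interior K) fun z => Real.log (reflectionVolume K z).toReal := by
  refine concaveOn_iff_forall_pos.2 ⟨hc.interior, fun x hx y hy a b ha hb hab => ?_⟩
  have hm := hK.measurableSet
  have key : reflectionVolume K x ^ a * reflectionVolume K y ^ b
      ≤ reflectionVolume K (a • x + b • y) := by
    refine volume_rpow_mul_volume_rpow_le (measurableSet_reflection hm x)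
      (measurableSet_reflection hm y) (measurableSet_reflection hm _) ha hb hab ?_
    rintro u ⟨hu, hu'⟩ v ⟨hv, hv'⟩
    refine ⟨hc hu hv ha.le hb.le hab, ?_⟩
    convert hc hu' hv' ha.le hb.le hab using 1
    module
  have pos : ∀ z ∈ interior K, 0 < (reflectionVolume K z).toReal := fun z hz =>
    ENNReal.toReal_pos (reflectionVolume_pos hz).ne' (reflectionVolume_ne_top hK z)
  have key' := ENNReal.toReal_mono (reflectionVolume_ne_top hK _) key
  rw [ENNReal.toReal_mul, ← ENNReal.toReal_rpow, ← ENNReal.toReal_rpow] at key'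
  have h := Real.log_le_log
    (mul_pos (Real.rpow_pos_of_pos (pos x hx) a) (Real.rpow_pos_of_pos (pos y hy) b)) key'
  rw [Real.log_mul (Real.rpow_pos_of_pos (pos x hx) a).ne' (Real.rpow_pos_of_pos (pos y hy) b).ne',
    Real.log_rpow (pos x hx), Real.log_rpow (pos y hy)] at h
  simpa using h

/-- A concave function on an open convex set lies below an affine function touching it at a given
point. -/
theorem ConcaveOn.exists_supergradient {E : Type*} [NormedAddCommGroup E] [NormedSpace ℝ E]
    [FiniteDimensional ℝ E] {s : Set E} {g : E → ℝ} (hg : ConcaveOn ℝ s g) (hs : IsOpen s)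
    {x₀ : E} (hx₀ : x₀ ∈ s) : ∃ p : E →L[ℝ] ℝ, ∀ z ∈ s, g z ≤ g x₀ + p (z - x₀) := by
  have hopen : IsOpen {q : E × ℝ | q.1 ∈ s ∧ q.2 < g q.1} := by
    have hcont : ContinuousOn (fun q : E × ℝ => g q.1 - q.2) (s ×ˢ Set.univ) :=
      ((hg.continuousOn hs).comp continuousOn_fst fun q hq => hq.1).sub continuousOn_snd
    convert hcont.isOpen_inter_preimage (hs.prod isOpen_univ) (isOpen_Ioi (a := (0 : ℝ))) using 1
    ext q
    simp
  obtain ⟨f, hf⟩ := geometric_hahn_banach_open_point hg.convex_strict_hypograph hopen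
    (x := (x₀, g x₀)) (by simp)
  have split : ∀ z t, f (z, t) = f (z, 0) + t * f (0, 1) := by
    intro z t
    have : ((z, t) : E × ℝ) = (z, 0) + t • ((0, 1) : E × ℝ) := by simp
    rw [this, map_add, map_smul, smul_eq_mul]
  have hq : 0 < f (0, 1) := by
    have := hf (x₀, g x₀ - 1) ⟨hx₀, by simp⟩
    rw [split, split x₀ (g x₀)] at this
    linarith
  refine ⟨-(f (0, 1))⁻¹ • f.comp (ContinuousLinearMap.inl ℝ E ℝ), fun z hz => ?_⟩
  refine le_of_forall_lt fun t ht => ?_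
  have h := hf (z, t) ⟨hz, ht⟩
  rw [split, split x₀ (g x₀)] at h
  have hsub : f (z - x₀, 0) = f (z, 0) - f (x₀, 0) := by
    rw [← map_sub]; simp
  simp only [smul_apply, ContinuousLinearMap.comp_apply, ContinuousLinearMap.inl_apply, smul_eq_mul, hsub]
  have h2 : t < g x₀ - (f (z, 0) - f (x₀, 0)) / f (0, 1) := by
    rw [lt_sub_iff_add_lt, ← lt_sub_iff_add_lt', div_lt_iff₀ hq]
    linarith
  rw [div_eq_inv_mul] at h2
  linarith

theorem exists_reflectionVolume_le (hK : IsCompact K) (hc : Convex ℝ K) (h0 : 0 ∈ interior K) :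
    ∃ p : EuclideanSpace ℝ (Fin d) →L[ℝ] ℝ, ∀ z ∈ interior K,
      reflectionVolume K z ≤ reflectionVolume K 0 * ENNReal.ofReal (Real.exp (p z)) := by
  obtain ⟨p, hp⟩ := (concaveOn_log_reflectionVolume hK hc).exists_supergradient isOpen_interior h0
  refine ⟨p, fun z hz => ?_⟩
  have pos : ∀ z ∈ interior K, 0 < (reflectionVolume K z).toReal := fun z hz =>
    ENNReal.toReal_pos (reflectionVolume_pos hz).ne' (reflectionVolume_ne_top hK z)
  have h := Real.exp_le_exp.2 (hp z hz)
  rw [Real.exp_add, Real.exp_log (pos z hz), Real.exp_log (pos 0 h0), sub_zero] at h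
  rw [← ENNReal.ofReal_toReal (reflectionVolume_ne_top hK z),
    ← ENNReal.ofReal_toReal (reflectionVolume_ne_top hK 0),
    ← ENNReal.ofReal_mul ENNReal.toReal_nonneg]
  exact ENNReal.ofReal_le_ofReal h

/-- The density of the midpoint of two independent uniform points of `K`. -/
theorem lintegral_midpoint_eq (hK : MeasurableSet K) {u : EuclideanSpace ℝ (Fin d) → ℝ≥0∞}
    (hu : Measurable u) :
    ∫⁻ x in K, ∫⁻ y in K, u ((1 / 2 : ℝ) • (x + y))
      = 2 ^ d * ∫⁻ z, u z * reflectionVolume K z := by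
  have subst : ∀ x, ∀ G : EuclideanSpace ℝ (Fin d) → ℝ≥0∞, Measurable G →
      ∫⁻ y, G y = 2 ^ d * ∫⁻ z, G ((2 : ℝ) • z - x) := by
    intro x G hG
    have h1 : ∫⁻ z, G ((2 : ℝ) • z - x) = ∫⁻ w, G (w - x)
        ∂(Measure.map (fun z : EuclideanSpace ℝ (Fin d) => (2 : ℝ) • z) volume) := by
      rw [lintegral_map (by fun_prop) (by fun_prop)]
    rw [h1, Measure.map_addHaar_smul _ two_ne_zero, lintegral_smul_measure,
      lintegral_sub_right_eq_self, smul_eq_mul, ← mul_assoc]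
    simp only [finrank_euclideanSpace, Fintype.card_fin]
    rw [abs_of_pos (by positivity), ENNReal.ofReal_inv_of_pos (by positivity),
      ENNReal.ofReal_pow (by norm_num), ENNReal.ofReal_ofNat,
      ENNReal.mul_inv_cancel (by positivity) (by finiteness), one_mul]
  have inner : ∀ x, ∫⁻ y in K, u ((1 / 2 : ℝ) • (x + y))
      = 2 ^ d * ∫⁻ z, K.indicator (fun _ => u z) ((2 : ℝ) • z - x) := by
    intro x
    rw [← lintegral_indicator hK, subst x _ (Measurable.indicator (by fun_prop) hK)]
    congr 2 with z
    by_cases hz : (2 : ℝ) • z - x ∈ K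
    · rw [Set.indicator_of_mem hz, Set.indicator_of_mem hz]
      congr 1
      module
    · rw [Set.indicator_of_notMem hz, Set.indicator_of_notMem hz]
  simp only [inner]
  have hjoint : Measurable fun q : EuclideanSpace ℝ (Fin d) × EuclideanSpace ℝ (Fin d) =>
      K.indicator (fun _ => u q.2) ((2 : ℝ) • q.2 - q.1) := by
    have : (fun q : EuclideanSpace ℝ (Fin d) × EuclideanSpace ℝ (Fin d) =>
      K.indicator (fun _ => u q.2) ((2 : ℝ) • q.2 - q.1)) =
      ((fun q : EuclideanSpace ℝ (Fin d) × EuclideanSpace ℝ (Fin d) =>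
        (2 : ℝ) • q.2 - q.1) ⁻¹' K).indicator (fun q => u q.2) := by
      ext q
      by_cases hq : (2 : ℝ) • q.2 - q.1 ∈ K <;> simp [hq]
    rw [this]
    exact (hu.comp measurable_snd).indicator
      (((measurable_snd.const_smul (2 : ℝ)).sub measurable_fst) hK)
  rw [lintegral_const_mul _ hjoint.lintegral_prod_right', lintegral_lintegral_swap
    hjoint.aemeasurable]
  congr 2 with z
  rw [reflectionVolume, ← lintegral_indicator hK,
    ← lintegral_indicator_const (measurableSet_reflection hK z)]
  congr 1 with x
  by_cases hx : x ∈ K <;> by_cases hz : (2 : ℝ) • z - x ∈ K <;> simp [hx, hz]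

/-- The uniform probability measure on `K`. -/
noncomputable def uniformMeasure (K : Set (EuclideanSpace ℝ (Fin d))) :
    Measure (EuclideanSpace ℝ (Fin d)) :=
  (volume K)⁻¹ • volume.restrict K

/-- The midpoint density of `K` relative to the uniform density, evaluated at the origin. -/
noncomputable def midpointRatio (K : Set (EuclideanSpace ℝ (Fin d))) : ℝ≥0∞ :=
  2 ^ d * reflectionVolume K 0 / volume K

theorem exists_lintegral_midpoint_le (hK : IsCompact K) (hc : Convex ℝ K)
    (h0 : 0 ∈ interior K) :
    ∃ p : EuclideanSpace ℝ (Fin d) →L[ℝ] ℝ, ∀ u : EuclideanSpace ℝ (Fin d) → ℝ≥0∞, Measurable u →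
      ∫⁻ x, ∫⁻ y, u ((1 / 2 : ℝ) • (x + y)) ∂uniformMeasure K ∂uniformMeasure K
        ≤ midpointRatio K * ∫⁻ z, u z * ENNReal.ofReal (Real.exp (p z)) ∂uniformMeasure K := by
  obtain ⟨p, hp⟩ := exists_reflectionVolume_le hK hc h0
  refine ⟨p, fun u hu => ?_⟩
  have hm := hK.measurableSet
  have bound : ∫⁻ z, u z * reflectionVolume K z
      ≤ reflectionVolume K 0 * ∫⁻ z in K, u z * ENNReal.ofReal (Real.exp (p z)) := by
    rw [← lintegral_const_mul _ (by fun_prop), ← lintegral_indicator hm]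
    refine lintegral_mono_ae ?_
    have hfr : ∀ᵐ z ∂volume, z ∉ frontier K := measure_eq_zero_iff_ae_notMem.1
      (hc.addHaar_frontier volume)
    filter_upwards [hfr] with z hz
    by_cases hzK : z ∈ K
    · have hzi : z ∈ interior K := by
        by_contra hcon
        exact hz ⟨subset_closure hzK, hcon⟩
      rw [Set.indicator_of_mem hzK, mul_left_comm]
      gcongr
      exact hp z hzi
    · rw [reflectionVolume_eq_zero hc hzK, mul_zero]
      exact bot_le
  have hmeas : Measurable fun x => ∫⁻ y in K, u ((1 / 2 : ℝ) • (x + y)) :=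
    Measurable.lintegral_prod_right' (f := fun q : EuclideanSpace ℝ (Fin d) ×
      EuclideanSpace ℝ (Fin d) => u ((1 / 2 : ℝ) • (q.1 + q.2))) (by fun_prop)
  simp only [uniformMeasure, lintegral_smul_measure, smul_eq_mul]
  rw [lintegral_const_mul _ hmeas, lintegral_midpoint_eq hm hu, midpointRatio]
  calc (volume K)⁻¹ * ((volume K)⁻¹ * (2 ^ d * ∫⁻ z, u z * reflectionVolume K z))
      ≤ (volume K)⁻¹ * ((volume K)⁻¹ * (2 ^ d * (reflectionVolume K 0 *
          ∫⁻ z in K, u z * ENNReal.ofReal (Real.exp (p z))))) := by gcongr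
    _ = _ := by rw [div_eq_mul_inv]; ring

end Reflection

section Averaging

open scoped ENNReal

variable {d : ℕ} {K : Set (EuclideanSpace ℝ (Fin d))}

theorem isProbabilityMeasure_uniformMeasure (hK : IsCompact K) (hint : (interior K).Nonempty) :
    IsProbabilityMeasure (uniformMeasure K) := by
  refine ⟨?_⟩
  have h0 : volume K ≠ 0 := (Measure.measure_pos_of_nonempty_interior volume hint).ne'
  simp [uniformMeasure, ENNReal.inv_mul_cancel h0 hK.measure_lt_top.ne]

theorem ae_mem_uniformMeasure (hK : MeasurableSet K) : ∀ᵐ x ∂uniformMeasure K, x ∈ K :=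
  (Measure.ae_smul_measure (ae_restrict_mem hK) _)

theorem integral_uniformMeasure {F : Type*} [NormedAddCommGroup F] [NormedSpace ℝ F]
    (f : EuclideanSpace ℝ (Fin d) → F) :
    ∫ x, f x ∂uniformMeasure K = (volume K).toReal⁻¹ • ∫ x in K, f x := by
  rw [uniformMeasure, integral_smul_measure, ENNReal.toReal_inv]

theorem Continuous.integrable_of_ae_mem_isCompact {X F : Type*} [TopologicalSpace X]
    [MeasurableSpace X] [OpensMeasurableSpace X] [NormedAddCommGroup F]
    [SecondCountableTopologyEither X F] {S : Set X} (hS : IsCompact S) {ν : Measure X}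
    [IsFiniteMeasure ν] (hν : ∀ᵐ x ∂ν, x ∈ S) {f : X → F} (hf : Continuous f) :
    Integrable f ν := by
  obtain ⟨C, hC⟩ := hS.exists_bound_of_continuousOn hf.continuousOn
  exact Integrable.of_bound hf.aestronglyMeasurable C (hν.mono hC)

/-- The law of the midpoint of two independent points of law `ν`. -/
noncomputable def midpointLaw (ν : Measure (EuclideanSpace ℝ (Fin d))) :
    Measure (EuclideanSpace ℝ (Fin d)) :=
  (ν.prod ν).map fun q => (1 / 2 : ℝ) • (q.1 + q.2)

section MidpointLaw

variable {ν : Measure (EuclideanSpace ℝ (Fin d))}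

theorem measurable_midpoint : Measurable
    fun q : EuclideanSpace ℝ (Fin d) × EuclideanSpace ℝ (Fin d) => (1 / 2 : ℝ) • (q.1 + q.2) := by
  fun_prop

theorem ae_mem_prod [SFinite ν] (hν : ∀ᵐ x ∂ν, x ∈ K) : ∀ᵐ q ∂ν.prod ν, q ∈ K ×ˢ K := by
  filter_upwards [Measure.quasiMeasurePreserving_fst.ae hν,
    Measure.quasiMeasurePreserving_snd.ae hν] with q h1 h2 using ⟨h1, h2⟩

variable [IsProbabilityMeasure ν]

instance : IsProbabilityMeasure (midpointLaw ν) :=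
  Measure.isProbabilityMeasure_map measurable_midpoint.aemeasurable

theorem ae_mem_midpointLaw (hK : MeasurableSet K) (hc : Convex ℝ K) (hν : ∀ᵐ x ∂ν, x ∈ K) :
    ∀ᵐ x ∂midpointLaw ν, x ∈ K := by
  refine (ae_map_iff measurable_midpoint.aemeasurable hK).2 ?_
  filter_upwards [ae_mem_prod hν] with q hq
  rw [smul_add]
  exact hc hq.1 hq.2 (by norm_num) (by norm_num) (by norm_num)

theorem integral_midpointLaw (hK : IsCompact K) (hν : ∀ᵐ x ∂ν, x ∈ K) {F : Type*}
    [NormedAddCommGroup F] [NormedSpace ℝ F] {f : EuclideanSpace ℝ (Fin d) → F}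
    (hf : Continuous f) :
    ∫ x, f x ∂midpointLaw ν = ∫ x, ∫ y, f ((1 / 2 : ℝ) • (x + y)) ∂ν ∂ν := by
  rw [midpointLaw, integral_map measurable_midpoint.aemeasurable hf.aestronglyMeasurable]
  exact integral_prod _
    (Continuous.integrable_of_ae_mem_isCompact (hK.prod hK) (ae_mem_prod hν) (by fun_prop))

theorem integral_id_midpointLaw (hK : IsCompact K) (hν : ∀ᵐ x ∂ν, x ∈ K)
    (h0 : ∫ x, x ∂ν = 0) : ∫ x, x ∂midpointLaw ν = 0 := by
  have hi : Integrable (fun x => x) ν :=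
    Continuous.integrable_of_ae_mem_isCompact hK hν continuous_id
  rw [integral_midpointLaw hK hν continuous_id']
  have : ∀ x, ∫ y, (1 / 2 : ℝ) • (x + y) ∂ν = (1 / 2 : ℝ) • x := by
    intro x
    rw [integral_smul, integral_add (integrable_const _) hi, h0]
    simp
  simp only [this]
  rw [integral_smul (1 / 2 : ℝ) fun x => x, h0, smul_zero]

theorem integral_norm_sq_midpointLaw (hK : IsCompact K) (hν : ∀ᵐ x ∂ν, x ∈ K)
    (h0 : ∫ x, x ∂ν = 0)
    (A : EuclideanSpace ℝ (Fin d) →L[ℝ] EuclideanSpace ℝ (Fin d)) :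
    ∫ x, ‖A x‖ ^ 2 ∂midpointLaw ν = (∫ x, ‖A x‖ ^ 2 ∂ν) / 2 := by
  have hid : Integrable (fun x => x) ν :=
    Continuous.integrable_of_ae_mem_isCompact hK hν continuous_id
  have hsq : Integrable (fun x => ‖A x‖ ^ 2) ν :=
    Continuous.integrable_of_ae_mem_isCompact hK hν (by fun_prop)
  rw [integral_midpointLaw hK hν (by fun_prop)]
  have : ∀ x, ∫ y, ‖A ((1 / 2 : ℝ) • (x + y))‖ ^ 2 ∂ν
      = 1 / 4 * ‖A x‖ ^ 2 + 1 / 4 * ∫ y, ‖A y‖ ^ 2 ∂ν := by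
    intro x
    have hL : ∫ y, ((innerSL ℝ (A x)).comp A) y ∂ν = 0 := by
      rw [ContinuousLinearMap.integral_comp_comm _ hid, h0, map_zero]
    have hLi : Integrable (fun y => ((innerSL ℝ (A x)).comp A) y) ν :=
      ContinuousLinearMap.integrable_comp _ hid
    have expand : ∀ y, ‖A ((1 / 2 : ℝ) • (x + y))‖ ^ 2
        = 1 / 4 * ‖A x‖ ^ 2 + (1 / 2 * ((innerSL ℝ (A x)).comp A) y + 1 / 4 * ‖A y‖ ^ 2) := by
      intro y
      rw [map_smul, map_add, norm_smul, mul_pow, norm_add_sq_real]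
      simp
      ring
    simp only [expand]
    have hsum : Integrable (fun y => 1 / 2 * ((innerSL ℝ (A x)).comp A) y + 1 / 4 * ‖A y‖ ^ 2) ν :=
      (hLi.const_mul _).add (hsq.const_mul _)
    rw [integral_add (integrable_const _) hsum,
      integral_add (hLi.const_mul _) (hsq.const_mul _),
      integral_const_mul (1 / 2 : ℝ) fun y => ((innerSL ℝ (A x)).comp A) y,
      integral_const_mul (1 / 4 : ℝ) fun y => ‖A y‖ ^ 2, hL]
    simp
  simp only [this]
  rw [integral_add (hsq.const_mul _) (integrable_const _), integral_const_mul]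
  simp
  ring

theorem lintegral_midpointLaw {u : EuclideanSpace ℝ (Fin d) → ℝ≥0∞} (hu : Measurable u) :
    ∫⁻ x, u x ∂midpointLaw ν = ∫⁻ x, ∫⁻ y, u ((1 / 2 : ℝ) • (x + y)) ∂ν ∂ν := by
  rw [midpointLaw, lintegral_map hu measurable_midpoint,
    lintegral_prod (fun q => u _) (hu.comp measurable_midpoint).aemeasurable]

end MidpointLaw

/-- The average of `2 ^ k` independent uniform points of a centred convex body `K` has, up to an
exponential tilt, density at most `midpointRatio K ^ (2 ^ k - 1)` relative to the uniform
measure on `K`. -/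
theorem exists_average_law (hK : IsCompact K) (hc : Convex ℝ K) (hint : (interior K).Nonempty)
    (h0 : ∫ x, x ∂uniformMeasure K = 0) {p : EuclideanSpace ℝ (Fin d) →L[ℝ] ℝ}
    (hp : ∀ u : EuclideanSpace ℝ (Fin d) → ℝ≥0∞, Measurable u →
      ∫⁻ x, ∫⁻ y, u ((1 / 2 : ℝ) • (x + y)) ∂uniformMeasure K ∂uniformMeasure K
        ≤ midpointRatio K * ∫⁻ z, u z * ENNReal.ofReal (Real.exp (p z)) ∂uniformMeasure K)
    (k : ℕ) :
    ∃ ν : Measure (EuclideanSpace ℝ (Fin d)), IsProbabilityMeasure ν ∧ (∀ᵐ x ∂ν, x ∈ K) ∧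
      ∫ x, x ∂ν = 0 ∧
      (∀ A : EuclideanSpace ℝ (Fin d) →L[ℝ] EuclideanSpace ℝ (Fin d),
        ∫ x, ‖A x‖ ^ 2 ∂ν = (∫ x, ‖A x‖ ^ 2 ∂uniformMeasure K) / 2 ^ k) ∧
      ∀ u : EuclideanSpace ℝ (Fin d) → ℝ≥0∞, Measurable u →
        ∫⁻ x, u x ∂ν ≤ midpointRatio K ^ (2 ^ k - 1) *
          ∫⁻ x, u x * ENNReal.ofReal (Real.exp (((2 : ℝ) ^ k - 1) * p x)) ∂uniformMeasure K := by
  induction k with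
  | zero =>
    refine ⟨uniformMeasure K, isProbabilityMeasure_uniformMeasure hK hint,
      ae_mem_uniformMeasure hK.measurableSet, h0, by simp, by simp⟩
  | succ k ih =>
    obtain ⟨ν, hν, hmem, hmean, hvar, hdom⟩ := ih
    have := isProbabilityMeasure_uniformMeasure hK hint
    refine ⟨midpointLaw ν, inferInstance, ae_mem_midpointLaw hK.measurableSet hc hmem,
      integral_id_midpointLaw hK hmem hmean, fun A => ?_, fun u hu => ?_⟩
    · rw [integral_norm_sq_midpointLaw hK hmem hmean, hvar, pow_succ, div_div]
    set R := midpointRatio K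
    set c : ℝ := (2 : ℝ) ^ k - 1 with hcdef
    have hw : Measurable fun x => ENNReal.ofReal (Real.exp (c * p x)) := by fun_prop
    rw [lintegral_midpointLaw hu]
    calc ∫⁻ x, ∫⁻ y, u ((1 / 2 : ℝ) • (x + y)) ∂ν ∂ν
        ≤ ∫⁻ x, R ^ (2 ^ k - 1) * ∫⁻ y, u ((1 / 2 : ℝ) • (x + y)) *
            ENNReal.ofReal (Real.exp (c * p y)) ∂uniformMeasure K ∂ν :=
          lintegral_mono fun x => hdom _ (by fun_prop)
      _ = R ^ (2 ^ k - 1) * ∫⁻ x, ∫⁻ y, u ((1 / 2 : ℝ) • (x + y)) *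
            ENNReal.ofReal (Real.exp (c * p y)) ∂uniformMeasure K ∂ν := by
          rw [lintegral_const_mul]
          exact Measurable.lintegral_prod_right' (f := fun q : EuclideanSpace ℝ (Fin d) ×
            EuclideanSpace ℝ (Fin d) => u ((1 / 2 : ℝ) • (q.1 + q.2)) *
              ENNReal.ofReal (Real.exp (c * p q.2))) (by fun_prop)
      _ ≤ R ^ (2 ^ k - 1) * (R ^ (2 ^ k - 1) * ∫⁻ x, (∫⁻ y, u ((1 / 2 : ℝ) • (x + y)) *
            ENNReal.ofReal (Real.exp (c * p y)) ∂uniformMeasure K) *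
              ENNReal.ofReal (Real.exp (c * p x)) ∂uniformMeasure K) := by
          gcongr
          refine hdom _ ?_
          exact Measurable.lintegral_prod_right' (f := fun q : EuclideanSpace ℝ (Fin d) ×
            EuclideanSpace ℝ (Fin d) => u ((1 / 2 : ℝ) • (q.1 + q.2)) *
              ENNReal.ofReal (Real.exp (c * p q.2))) (by fun_prop)
      _ = R ^ (2 ^ k - 1) * (R ^ (2 ^ k - 1) * ∫⁻ x, ∫⁻ y, (fun z => u z *
            ENNReal.ofReal (Real.exp (2 * c * p z))) ((1 / 2 : ℝ) • (x + y))
              ∂uniformMeasure K ∂uniformMeasure K) := by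
          congr 3 with x
          rw [← lintegral_mul_const _ (by fun_prop)]
          congr 1 with y
          rw [mul_assoc, ← ENNReal.ofReal_mul (Real.exp_nonneg _), ← Real.exp_add]
          congr 3
          rw [map_smul, map_add, smul_eq_mul]
          ring
      _ ≤ R ^ (2 ^ k - 1) * (R ^ (2 ^ k - 1) * (R * ∫⁻ z, (u z *
            ENNReal.ofReal (Real.exp (2 * c * p z))) * ENNReal.ofReal (Real.exp (p z))
              ∂uniformMeasure K)) := by
          gcongr
          exact hp _ (by fun_prop)
      _ = R ^ (2 ^ (k + 1) - 1) * ∫⁻ x, u x *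
            ENNReal.ofReal (Real.exp (((2 : ℝ) ^ (k + 1) - 1) * p x)) ∂uniformMeasure K := by
          have hpow : R ^ (2 ^ (k + 1) - 1) = R ^ (2 ^ k - 1) * (R ^ (2 ^ k - 1) * R) := by
            rw [← pow_succ, ← pow_add]
            congr 1
            have := Nat.one_le_two_pow (n := k)
            rw [pow_succ]
            omega
          rw [hpow, mul_assoc, mul_assoc]
          congr 4 with x
          rw [mul_assoc, ← ENNReal.ofReal_mul (Real.exp_nonneg _), ← Real.exp_add]
          congr 3
          rw [hcdef, pow_succ]
          ring

theorem midpointRatio_ne_top (hK : IsCompact K) (hint : (interior K).Nonempty) :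
    midpointRatio K ≠ ∞ :=
  ENNReal.div_ne_top (ENNReal.mul_ne_top (by finiteness) (reflectionVolume_ne_top hK 0))
    (Measure.measure_pos_of_nonempty_interior volume hint).ne'

theorem exp_le_midpointRatio_pow_mul (hK : IsCompact K) (hc : Convex ℝ K) (hint : 0 ∈ interior K)
    (h0 : ∫ x, x ∂uniformMeasure K = 0)
    (A : EuclideanSpace ℝ (Fin d) →L[ℝ] EuclideanSpace ℝ (Fin d)) (l : ℝ) (k : ℕ) :
    Real.exp (-l * ((∫ x, ‖A x‖ ^ 2 ∂uniformMeasure K) / 2 ^ k)) ≤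
      (midpointRatio K).toReal ^ (2 ^ k - 1) * ∫ x, Real.exp (-l * ‖A x‖ ^ 2) ∂uniformMeasure K := by
  obtain ⟨p, hp⟩ := exists_lintegral_midpoint_le hK hc hint
  obtain ⟨ν, hν, hmem, hmean, hvar, hdom⟩ := exists_average_law hK hc ⟨0, hint⟩ h0 hp k
  have := isProbabilityMeasure_uniformMeasure hK ⟨0, hint⟩
  set c : ℝ := (2 : ℝ) ^ k - 1
  have hid : Integrable (fun x => x) ν :=
    Continuous.integrable_of_ae_mem_isCompact hK hmem continuous_id
  have hsq : Integrable (fun x => ‖A x‖ ^ 2) ν :=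
    Continuous.integrable_of_ae_mem_isCompact hK hmem (by fun_prop)
  have hmean' : ∫ x, (-l * ‖A x‖ ^ 2 - c * p x) ∂ν
      = -l * ((∫ x, ‖A x‖ ^ 2 ∂uniformMeasure K) / 2 ^ k) := by
    rw [integral_sub (hsq.const_mul _) ((p.integrable_comp hid).const_mul _), integral_const_mul,
      integral_const_mul, p.integral_comp_comm hid, hmean, hvar]
    simp
  have hcont : Continuous fun x => Real.exp (-l * ‖A x‖ ^ 2 - c * p x) := by fun_prop
  have hexp : Integrable (fun x => Real.exp (-l * ‖A x‖ ^ 2 - c * p x)) ν :=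
    Continuous.integrable_of_ae_mem_isCompact hK hmem hcont
  have hexp' : Integrable (fun x => Real.exp (-l * ‖A x‖ ^ 2)) (uniformMeasure K) :=
    Continuous.integrable_of_ae_mem_isCompact hK (ae_mem_uniformMeasure hK.measurableSet)
      (by fun_prop)
  have jensen : Real.exp (-l * ((∫ x, ‖A x‖ ^ 2 ∂uniformMeasure K) / 2 ^ k))
      ≤ ∫ x, Real.exp (-l * ‖A x‖ ^ 2 - c * p x) ∂ν := by
    rw [← hmean']
    exact convexOn_exp.map_integral_le Real.continuous_exp.continuousOn isClosed_univ
      (by simp) ((hsq.const_mul _).sub ((p.integrable_comp hid).const_mul _)) hexp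
  refine jensen.trans ?_
  have hR := midpointRatio_ne_top hK ⟨0, hint⟩
  have hbound := hdom (fun x => ENNReal.ofReal (Real.exp (-l * ‖A x‖ ^ 2 - c * p x)))
    hcont.measurable.ennreal_ofReal
  simp only [← ENNReal.ofReal_mul (Real.exp_nonneg _), ← Real.exp_add, sub_add_cancel] at hbound
  rw [← ofReal_integral_eq_lintegral_ofReal hexp (by filter_upwards with x using Real.exp_nonneg _),
    ← ofReal_integral_eq_lintegral_ofReal hexp'
      (by filter_upwards with x using Real.exp_nonneg _)] at hbound
  have := ENNReal.toReal_mono (ENNReal.mul_ne_top (ENNReal.pow_ne_top hR) ENNReal.ofReal_ne_top)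
    hbound
  rwa [ENNReal.toReal_mul, ENNReal.toReal_pow,
    ENNReal.toReal_ofReal (integral_nonneg fun _ => Real.exp_nonneg _),
    ENNReal.toReal_ofReal (integral_nonneg fun _ => Real.exp_nonneg _)] at this

end Averaging

section Isotropic

open scoped ENNReal

variable {d : ℕ} {K : Set (EuclideanSpace ℝ (Fin d))}

theorem centroid_eq_integral_uniformMeasure (K : Set (EuclideanSpace ℝ (Fin d))) :
    centroid K = ∫ x, x ∂uniformMeasure K := by
  rw [integral_uniformMeasure, centroid]

theorem covMatrix_apply_of_centroid_eq_zero (h0 : centroid K = 0) (i j : Fin d) :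
    covMatrix K i j = ∫ x, x i * x j ∂uniformMeasure K := by
  simp [integral_uniformMeasure, covMatrix, h0]

theorem zero_mem_interior_of_centroid_eq_zero (hK : IsCompact K) (hc : Convex ℝ K)
    (hint : (interior K).Nonempty) (h0 : centroid K = 0) : 0 ∈ interior K := by
  by_contra hcon
  obtain ⟨f, hf⟩ := geometric_hahn_banach_open_point hc.interior isOpen_interior hcon
  have hvol : 0 < volume (interior K) := isOpen_interior.measure_pos volume hint
  have hid : IntegrableOn (fun x : EuclideanSpace ℝ (Fin d) => x) K volume :=
    continuous_id.continuousOn.integrableOn_compact hK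
  have hmean : ∫ x in K, x = 0 := by
    have hv : (volume K).toReal⁻¹ ≠ 0 := inv_ne_zero (ENNReal.toReal_ne_zero.2
      ⟨(Measure.measure_pos_of_nonempty_interior volume hint).ne', hK.measure_lt_top.ne⟩)
    exact (smul_eq_zero.1 h0).resolve_left hv
  have hle : ∀ x ∈ K, f x ≤ 0 := by
    intro x hx
    have hx' : x ∈ closure (interior K) := by
      rw [hc.closure_interior_eq_closure_of_nonempty_interior hint]
      exact subset_closure hx
    refine closure_minimal (t := {y | f y ≤ 0}) (fun y hy => ?_)
      (isClosed_le f.continuous continuous_const) hx'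
    simpa using (hf y hy).le
  have hpos : 0 < ∫ x in K, (-f) x := by
    rw [setIntegral_pos_iff_support_of_nonneg_ae]
    · refine hvol.trans_le (measure_mono fun x hx => ⟨?_, interior_subset hx⟩)
      have := hf x hx
      rw [map_zero] at this
      simpa using this.ne
    · filter_upwards [ae_restrict_mem hK.measurableSet] with x hx
      simpa using hle x hx
    · exact (-f).integrable_comp hid
  rw [ContinuousLinearMap.integral_comp_comm _ hid, hmean, map_zero] at hpos
  exact lt_irrefl _ hpos

theorem integrable_coord_mul_coord (hK : IsCompact K) (hint : (interior K).Nonempty)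
    (i j : Fin d) : Integrable (fun x => x i * x j) (uniformMeasure K) := by
  have := isProbabilityMeasure_uniformMeasure hK hint
  exact Continuous.integrable_of_ae_mem_isCompact hK (ae_mem_uniformMeasure hK.measurableSet)
    (by fun_prop)

theorem integral_sq_dotProduct (hK : IsCompact K) (hint : (interior K).Nonempty)
    (h0 : centroid K = 0) (a : Fin d → ℝ) :
    ∫ x, (∑ j, a j * x j) ^ 2 ∂uniformMeasure K = a ⬝ᵥ (covMatrix K).mulVec a := by
  have hexp : ∀ x : EuclideanSpace ℝ (Fin d), (∑ j, a j * x j) ^ 2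
      = ∑ i, ∑ j, a i * a j * (x i * x j) := by
    intro x
    rw [sq, Finset.sum_mul_sum]
    refine Finset.sum_congr rfl fun i _ => Finset.sum_congr rfl fun j _ => by ring
  have hi := integrable_coord_mul_coord hK hint
  simp only [hexp]
  rw [integral_finsetSum _ fun i _ => integrable_finsetSum _ fun j _ => (hi i j).const_mul _]
  simp only [dotProduct, Matrix.mulVec, Finset.mul_sum]
  refine Finset.sum_congr rfl fun i _ => ?_
  rw [integral_finsetSum _ fun j _ => (hi i j).const_mul _]
  refine Finset.sum_congr rfl fun j _ => ?_
  rw [integral_const_mul, covMatrix_apply_of_centroid_eq_zero h0]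
  ring

theorem posSemidef_covMatrix (hK : IsCompact K) (hint : (interior K).Nonempty)
    (h0 : centroid K = 0) : (covMatrix K).PosSemidef := by
  refine Matrix.PosSemidef.of_dotProduct_mulVec_nonneg ?_ fun a => ?_
  · ext i j
    simp [covMatrix, mul_comm]
  · simp only [star_trivial]
    rw [← integral_sq_dotProduct hK hint h0 a]
    exact integral_nonneg fun x => sq_nonneg _

theorem integral_norm_sq_toEuclideanCLM (hK : IsCompact K) (hint : (interior K).Nonempty)
    (h0 : centroid K = 0) (A : Matrix (Fin d) (Fin d) ℝ) :
    ∫ x, ‖Matrix.toEuclideanCLM (𝕜 := ℝ) A x‖ ^ 2 ∂uniformMeasure K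
      = (A * covMatrix K * A.transpose).trace := by
  have := isProbabilityMeasure_uniformMeasure hK hint
  have hexp : ∀ x : EuclideanSpace ℝ (Fin d), ‖Matrix.toEuclideanCLM (𝕜 := ℝ) A x‖ ^ 2
      = ∑ i, (∑ j, A i j * x j) ^ 2 := by
    intro x
    rw [EuclideanSpace.norm_sq_eq]
    simp [Matrix.ofLp_toEuclideanCLM, Matrix.mulVec, dotProduct]
  simp only [hexp]
  rw [integral_finsetSum _ fun i _ => Continuous.integrable_of_ae_mem_isCompact hK
    (ae_mem_uniformMeasure hK.measurableSet) (by fun_prop)]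
  simp only [integral_sq_dotProduct hK hint h0, Matrix.trace, Matrix.diag]
  refine Finset.sum_congr rfl fun i _ => ?_
  rw [mul_assoc A, Matrix.mul_apply]
  simp [dotProduct, Matrix.mulVec, Matrix.mul_apply, Matrix.transpose_apply]

theorem exists_isotropic_matrix (hK : IsCompact K) (hint : (interior K).Nonempty)
    (h0 : centroid K = 0) (hdet : (covMatrix K).det ≠ 0) :
    ∃ A : Matrix (Fin d) (Fin d) ℝ, A * covMatrix K * A.transpose = 1 := by
  open scoped MatrixOrder Matrix.Norms.L2Operator in
  obtain ⟨B, hB⟩ := CStarAlgebra.nonneg_iff_eq_star_mul_self.1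
    (posSemidef_covMatrix hK hint h0).nonneg
  rw [Matrix.star_eq_conjTranspose, Matrix.conjTranspose_eq_transpose_of_trivial] at hB
  have hBdet : IsUnit B.det := by
    rw [isUnit_iff_ne_zero]
    intro h
    exact hdet (by rw [hB, Matrix.det_mul, h, mul_zero])
  refine ⟨B.transpose⁻¹, ?_⟩
  rw [hB, Matrix.transpose_nonsing_inv, Matrix.transpose_transpose, ← mul_assoc,
    Matrix.nonsing_inv_mul _ (by rwa [Matrix.det_transpose]), one_mul,
    Matrix.mul_nonsing_inv _ hBdet]

theorem integral_exp_neg_norm_sq_comp (A : Matrix (Fin d) (Fin d) ℝ) (hA : A.det ≠ 0) {l : ℝ}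
    (hl : 0 < l) :
    ∫ x, Real.exp (-l * ‖Matrix.toEuclideanCLM (𝕜 := ℝ) A x‖ ^ 2)
      = |A.det|⁻¹ * (Real.pi / l) ^ ((d : ℝ) / 2) := by
  set T : EuclideanSpace ℝ (Fin d) →ₗ[ℝ] EuclideanSpace ℝ (Fin d) :=
    (Matrix.toEuclideanCLM (𝕜 := ℝ) A).toLinearMap
  have hT : LinearMap.det T = A.det := by
    have : T = Matrix.toLin (EuclideanSpace.basisFun (Fin d) ℝ).toBasis
        (EuclideanSpace.basisFun (Fin d) ℝ).toBasis A := by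
      simp [T, Matrix.coe_toEuclideanCLM_eq_toEuclideanLin, Matrix.toEuclideanLin_eq_toLin_orthonormal]
    rw [this, LinearMap.det_toLin]
  have hTm : Measurable T := (Matrix.toEuclideanCLM (𝕜 := ℝ) A).continuous.measurable
  have h := integral_map (μ := volume) (φ := T) hTm.aemeasurable
    (f := fun x => Real.exp (-l * ‖x‖ ^ 2)) (by fun_prop)
  rw [Measure.map_linearMap_addHaar_eq_smul_addHaar _ (by rwa [hT]), integral_smul_measure,
    GaussianFourier.integral_rexp_neg_mul_sq_norm hl, hT,
    ENNReal.toReal_ofReal (abs_nonneg _), abs_inv] at h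
  simpa [T] using h.symm

theorem integral_uniformMeasure_exp_le (K : Set (EuclideanSpace ℝ (Fin d)))
    (A : Matrix (Fin d) (Fin d) ℝ) (hA : A.det ≠ 0) {l : ℝ} (hl : 0 < l) :
    ∫ x, Real.exp (-l * ‖Matrix.toEuclideanCLM (𝕜 := ℝ) A x‖ ^ 2) ∂uniformMeasure K
      ≤ (volume K).toReal⁻¹ * (|A.det|⁻¹ * (Real.pi / l) ^ ((d : ℝ) / 2)) := by
  have hpos : 0 < |A.det|⁻¹ * (Real.pi / l) ^ ((d : ℝ) / 2) := by positivity
  rw [integral_uniformMeasure, smul_eq_mul, ← integral_exp_neg_norm_sq_comp A hA hl]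
  refine mul_le_mul_of_nonneg_left (setIntegral_le_integral ?_
    (Filter.Eventually.of_forall fun x => Real.exp_nonneg _)) (by positivity)
  by_contra hcon
  have := integral_exp_neg_norm_sq_comp A hA hl
  rw [integral_undef hcon] at this
  exact hpos.ne this

theorem reflectionVolume_zero_le_of_inter_intLattice (hc : Convex ℝ K)
    (hlattice : K ∩ intLattice d = {0}) : reflectionVolume K 0 ≤ 2 ^ d := by
  by_contra! hcon
  set b := EuclideanSpace.basisFun (Fin d) ℝ
  have hfund := ZSpan.isAddFundamentalDomain b.toBasis volume
  have hone : volume (ZSpan.fundamentalDomain b.toBasis) = 1 := by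
    rw [measure_congr (ZSpan.fundamentalDomain_ae_parallelepiped b.toBasis volume)]
    simpa using b.volume_parallelepiped
  have : Countable (Submodule.span ℤ (Set.range b.toBasis)).toAddSubgroup :=
    inferInstanceAs (Countable (Submodule.span ℤ (Set.range b.toBasis)))
  obtain ⟨x, hx0, hx⟩ := exists_ne_zero_mem_lattice_of_measure_mul_two_pow_lt_measure
    (L := (Submodule.span ℤ (Set.range b.toBasis)).toAddSubgroup) (μ := volume)
    (s := {x | x ∈ K ∧ (2 : ℝ) • (0 : EuclideanSpace ℝ (Fin d)) - x ∈ K}) hfund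
    (fun x hx => by simpa [and_comm] using hx)
    (fun x hx y hy s t hs ht hst => ⟨hc hx.1 hy.1 hs ht hst, by
      convert hc hx.2 hy.2 hs ht hst using 1
      module⟩)
    (by simpa [hone, reflectionVolume] using hcon)
  have hxl : (x : EuclideanSpace ℝ (Fin d)) ∈ intLattice d := by
    intro i
    obtain ⟨n, hn⟩ := (b.toBasis.mem_span_iff_repr_mem ℤ _).1 x.2 i
    exact ⟨n, by simpa [b] using hn.symm⟩
  have hmem : (x : EuclideanSpace ℝ (Fin d)) ∈ K ∩ intLattice d := ⟨hx.1, hxl⟩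
  rw [hlattice] at hmem
  exact hx0 (Subtype.ext hmem)

theorem exp_div_le_of_forall_exp_le_pow_mul {s L R : ℝ} (hs : 0 < s) (hL : 0 < L) (hR : 0 ≤ R)
    (h : ∀ k : ℕ, Real.exp (-(Real.pi * L ^ 2 * Real.exp 1 ^ 2) * (s / 2 ^ k))
      ≤ R ^ (2 ^ k - 1) * Real.exp (-s)) :
    Real.exp (s / (2 ^ 16 * L ^ 2)) ≤ R := by
  have hconst : Real.pi * Real.exp 1 ^ 2 ≤ 32 := by
    have h1 := Real.pi_lt_four
    have h2 : Real.exp 1 < 2.7182818286 := Real.exp_one_lt_d9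
    have h3 : Real.exp 1 ^ 2 ≤ 8 := by nlinarith [Real.exp_pos 1]
    nlinarith [Real.pi_pos]
  have hex : ∃ k : ℕ, 64 * L ^ 2 ≤ 2 ^ k := by
    obtain ⟨k, hk⟩ := pow_unbounded_of_one_lt (64 * L ^ 2) one_lt_two
    exact ⟨k, hk.le⟩
  classical
  obtain ⟨k, hk, hmin⟩ : ∃ k : ℕ, 64 * L ^ 2 ≤ 2 ^ k ∧ ∀ m < k, ¬ 64 * L ^ 2 ≤ 2 ^ m :=
    ⟨Nat.find hex, Nat.find_spec hex, fun m => Nat.find_min hex⟩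
  have hL2 : 0 < L ^ 2 := by positivity
  have hhalf : Real.pi * L ^ 2 * Real.exp 1 ^ 2 * (s / 2 ^ k) ≤ s / 2 := by
    have h1 : Real.pi * L ^ 2 * Real.exp 1 ^ 2 ≤ 2 ^ k / 2 := by nlinarith
    calc Real.pi * L ^ 2 * Real.exp 1 ^ 2 * (s / 2 ^ k) ≤ 2 ^ k / 2 * (s / 2 ^ k) := by gcongr
      _ = s / 2 := by field_simp
  have hpow : Real.exp (s / 2) ≤ R ^ (2 ^ k - 1) := by
    have h1 : Real.exp (-(s / 2)) ≤ R ^ (2 ^ k - 1) * Real.exp (-s) :=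
      (Real.exp_le_exp.2 (by linarith)).trans (h k)
    calc Real.exp (s / 2) = Real.exp (-(s / 2)) * Real.exp s := by
          rw [← Real.exp_add]; ring_nf
      _ ≤ R ^ (2 ^ k - 1) * Real.exp (-s) * Real.exp s := by gcongr
      _ = R ^ (2 ^ k - 1) := by rw [mul_assoc, ← Real.exp_add]; simp
  rcases k with _ | m
  · have : 1 < Real.exp (s / 2) := Real.one_lt_exp_iff.2 (by linarith)
    simp at hpow
    linarith
  · have hm : (2 : ℝ) ^ m < 64 * L ^ 2 := not_le.1 (hmin m m.lt_succ_self)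
    have hn : 2 ^ (m + 1) - 1 ≠ 0 := by
      have := Nat.one_lt_two_pow m.succ_ne_zero
      omega
    refine le_of_pow_le_pow_left₀ hn hR (le_trans ?_ hpow)
    rw [← Real.exp_nat_mul, Real.exp_le_exp, Nat.cast_sub Nat.one_le_two_pow]
    push_cast
    rw [mul_div_assoc', div_le_iff₀ (by positivity), pow_succ]
    nlinarith

theorem one_le_midpointRatio (hK : IsCompact K) (hc : Convex ℝ K)
    (hint : (interior K).Nonempty) (h0 : centroid K = 0) : 1 ≤ (midpointRatio K).toReal := by
  have := isProbabilityMeasure_uniformMeasure hK hint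
  simpa using exp_le_midpointRatio_pow_mul hK hc
    (zero_mem_interior_of_centroid_eq_zero hK hc hint h0)
    (by rw [← centroid_eq_integral_uniformMeasure, h0]) 0 0 1

/-- The volume of the symmetrisation `K ∩ -K` exceeds `2⁻ᵈ vol(K)` by a factor exponential in the
dimension, unless the isotropic constant is large. -/
theorem exp_le_midpointRatio (hd : 1 ≤ d) (hK : IsCompact K) (hc : Convex ℝ K)
    (hint : (interior K).Nonempty) (h0 : centroid K = 0) :
    Real.exp (d / (2 ^ 16 * isotropicConstant K ^ 2)) ≤ (midpointRatio K).toReal := by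
  have hd0 : (d : ℝ) ≠ 0 := by positivity
  by_cases hdet : (covMatrix K).det = 0
  · have hL : isotropicConstant K = 0 := by
      rw [isotropicConstant, hdet, Real.sqrt_zero, zero_div, Real.zero_rpow (inv_ne_zero hd0)]
    simpa [hL] using one_le_midpointRatio hK hc hint h0
  have hdet' : 0 < (covMatrix K).det :=
    lt_of_le_of_ne (posSemidef_covMatrix hK hint h0).det_nonneg (Ne.symm hdet)
  have hv : 0 < (volume K).toReal := ENNReal.toReal_pos
    (Measure.measure_pos_of_nonempty_interior volume hint).ne' hK.measure_lt_top.ne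
  have hL : 0 < isotropicConstant K := by
    unfold isotropicConstant
    positivity
  have hLd : isotropicConstant K ^ d = Real.sqrt (covMatrix K).det / (volume K).toReal :=
    Real.rpow_inv_natCast_pow (by positivity) (by omega)
  obtain ⟨A, hA⟩ := exists_isotropic_matrix hK hint h0 hdet
  have hAdet : A.det * (covMatrix K).det * A.det = 1 := by
    have := congrArg Matrix.det hA
    simpa [Matrix.det_mul] using this
  have hA0 : A.det ≠ 0 := by
    rintro h
    simp [h] at hAdet
  have hAabs : |A.det|⁻¹ = Real.sqrt (covMatrix K).det := by
    rw [eq_comm, Real.sqrt_eq_iff_mul_self_eq hdet'.le (by positivity), ← mul_inv,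
      abs_mul_abs_self]
    field_simp
    linarith
  set L := isotropicConstant K
  set l := Real.pi * L ^ 2 * Real.exp 1 ^ 2
  have hl : 0 < l := by positivity
  have hgauss : (volume K).toReal⁻¹ * (|A.det|⁻¹ * (Real.pi / l) ^ ((d : ℝ) / 2))
      = Real.exp (-d) := by
    have h1 : Real.pi / l = ((L * Real.exp 1)⁻¹) ^ 2 := by
      simp only [l]
      have := Real.pi_ne_zero
      field_simp
    have h2 : (Real.pi / l) ^ ((d : ℝ) / 2) = ((L * Real.exp 1)⁻¹) ^ d := by
      rw [h1, ← Real.rpow_natCast _ 2, ← Real.rpow_mul (by positivity), ← Real.rpow_natCast _ d]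
      congr 1
      push_cast
      ring
    rw [h2, hAabs, ← mul_assoc, inv_mul_eq_div, ← hLd, ← mul_pow, mul_inv, ← mul_assoc,
      mul_inv_cancel₀ hL.ne', one_mul, ← Real.exp_neg, ← Real.exp_nat_mul]
    ring_nf
  refine exp_div_le_of_forall_exp_le_pow_mul (by positivity) hL ENNReal.toReal_nonneg fun k => ?_
  have hmain := exp_le_midpointRatio_pow_mul hK hc
    (zero_mem_interior_of_centroid_eq_zero hK hc hint h0)
    (by rw [← centroid_eq_integral_uniformMeasure, h0]) (Matrix.toEuclideanCLM (𝕜 := ℝ) A) l k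
  rw [integral_norm_sq_toEuclideanCLM hK hint h0, hA, Matrix.trace_one, Fintype.card_fin] at hmain
  refine hmain.trans ?_
  rw [← hgauss]
  gcongr
  exact integral_uniformMeasure_exp_le K A hA0 hl

end Isotropic

/-- Let `d ≥ 1` and let `K ⊆ ℝ^d` be a convex body whose centre of mass is the origin
and such that `K ∩ ℤ^d = {0}`. Then `vol(K) ≤ exp(-d / (2^16 L_K²)) · 4^d`. -/
theorem ehrhart_isotropic {d : ℕ} (hd : 1 ≤ d) (K : Set (EuclideanSpace ℝ (Fin d)))
    (hcpt : IsCompact K) (hconv : Convex ℝ K) (hint : (interior K).Nonempty)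
    (hcentred : centroid K = 0) (hlattice : K ∩ intLattice d = {0}) :
    (volume K).toReal ≤
      Real.exp (-(d : ℝ) / (2 ^ 16 * (isotropicConstant K) ^ 2)) * 4 ^ d := by
  have hv : 0 < (volume K).toReal := ENNReal.toReal_pos
    (Measure.measure_pos_of_nonempty_interior volume hint).ne' hcpt.measure_lt_top.ne
  have hF : (reflectionVolume K 0).toReal ≤ 2 ^ d := by
    have := ENNReal.toReal_mono (by finiteness)
      (reflectionVolume_zero_le_of_inter_intLattice hconv hlattice)
    simpa using this
  have hR : (midpointRatio K).toReal ≤ 4 ^ d / (volume K).toReal := by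
    rw [midpointRatio, ENNReal.toReal_div, ENNReal.toReal_mul, ENNReal.toReal_pow,
      ENNReal.toReal_ofNat]
    gcongr
    calc (2 : ℝ) ^ d * (reflectionVolume K 0).toReal ≤ 2 ^ d * 2 ^ d := by gcongr
      _ = 4 ^ d := by rw [← mul_pow]; norm_num
  have h := (exp_le_midpointRatio hd hcpt hconv hint hcentred).trans hR
  rw [le_div_iff₀ hv] at h
  rw [neg_div, Real.exp_neg, ← div_eq_inv_mul, le_div_iff₀ (Real.exp_pos _)]
  linarith
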